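/- arXiv:math/0301054 — 3 statements merged into one kernel-verified Lean document; each statement's English description precedes it below -/
import Mathlib

section
/- If a continuous triangular map T on I × I is of type greater than 2^∞, i.e. T has a periodic point whose minimal period is not a power of 2, then the topological entropy of T is positive: h(T) > 0. -/
open Function Dynamics

/-- The unit interval `[0,1]`. -/
local notation "I" => unitInterval

/-- The triangular map `T(x,y) = (f x, g (x,y))` on `I × I`. -/
def triMap (f : I → I) (g : I × I → I) : I × I → I × I :=
  fun z => (f z.1, g z)

/-- `z` is a periodic point of `F` of minimal period `n`:
`F^[n] z = z` and `F^[k] z ≠ z` for `0 < k < n`. -/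
def MinPeriod {X : Type*} (F : X → X) (z : X) (n : ℕ) : Prop :=
  0 < n ∧ F^[n] z = z ∧ ∀ k, 0 < k → k < n → F^[k] z ≠ z

/-- If every word in the two symbols `S true`, `S false` is followed by some orbit of `T^[M]`, and
the two sets are separated by an entourage, then `T` has positive topological entropy. -/
theorem coverEntropy_pos_of_realizes_words {X : Type*} [UniformSpace X] (T : X → X) {M : ℕ}
    (hM : M ≠ 0) (S : Bool → Set X) {U : SetRel X X} (hU : U ∈ uniformity X)
    (hdisj : ∀ a ∈ S true, ∀ b ∈ S false, Disjoint (UniformSpace.ball a U) (UniformSpace.ball b U))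
    (hwords : ∀ (n : ℕ) (w : ℕ → Bool), ∃ x, ∀ i < n, (T^[M])^[i] x ∈ S (w i)) :
    0 < coverEntropy T Set.univ := by
  classical
  have hcard (n : ℕ) : (2 : ENNReal) ^ n ≤ (netMaxcard T Set.univ U (M * n) : ENNReal) := by
    have hex : ∀ w : Fin n → Bool, ∃ x, ∀ i : Fin n, (T^[M])^[(i : ℕ)] x ∈ S (w i) := by
      intro w
      obtain ⟨x, hx⟩ := hwords n fun i => if h : i < n then w ⟨i, h⟩ else true
      exact ⟨x, fun i => by simpa using hx i i.2⟩
    choose x hx using hex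
    have hsep : ∀ w v, w ≠ v → Disjoint (UniformSpace.ball (x w) (dynEntourage T U (M * n)))
        (UniformSpace.ball (x v) (dynEntourage T U (M * n))) := by
      intro w v hwv
      obtain ⟨i, hi⟩ := Function.ne_iff.1 hwv
      have hlt : M * (i : ℕ) < M * n := Nat.mul_lt_mul_of_pos_left i.2 (Nat.pos_of_ne_zero hM)
      have hw := hx w i
      have hv := hx v i
      rw [← Function.iterate_mul] at hw hv
      rw [Set.disjoint_left]
      intro y hyw hyv
      have hyw := mem_ball_dynEntourage.1 hyw _ hlt
      have hyv := mem_ball_dynEntourage.1 hyv _ hlt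
      cases hwi : w i <;> cases hvi : v i <;> rw [hwi] at hw hi <;> rw [hvi] at hv hi
      · exact hi rfl
      · exact Set.disjoint_left.1 (hdisj _ hv _ hw) hyv hyw
      · exact Set.disjoint_left.1 (hdisj _ hw _ hv) hyw hyv
      · exact hi rfl
    have hself : ∀ y, y ∈ UniformSpace.ball y (dynEntourage T U (M * n)) := fun y =>
      mem_ball_dynEntourage.2 fun k _ => UniformSpace.mem_ball_self _ hU
    have hinj : Function.Injective x := by
      intro w v hwv
      by_contra hne
      exact Set.disjoint_left.1 (hsep w v hne) (hself _) (hwv ▸ hself _)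
    have hnet : IsDynNetIn T Set.univ U (M * n) (Finset.univ.image x : Finset X) := by
      refine ⟨Set.subset_univ _, ?_⟩
      intro a ha b hb hab
      simp only [Finset.coe_image, Finset.coe_univ, Set.image_univ, Set.mem_range] at ha hb
      obtain ⟨w, rfl⟩ := ha
      obtain ⟨v, rfl⟩ := hb
      exact hsep w v fun h => hab (congrArg x h)
    have h := hnet.card_le_netMaxcard
    rw [Finset.card_image_of_injective _ hinj] at h
    have h' := ENat.toENNReal_mono h
    simpa using h'
  have hgrow : ENNReal.log 2 ≤ (M : EReal) * netEntropyEntourage T Set.univ U := by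
    have hmono : Monotone fun n : ℕ => (netMaxcard T Set.univ U n : ENNReal) :=
      fun _ _ h => ENat.toENNReal_mono (netMaxcard_monotone_time T Set.univ U h)
    rw [netEntropyEntourage, ← hmono.expGrowthSup_comp_mul hM, ← ExpGrowth.expGrowthSup_pow]
    exact ExpGrowth.expGrowthSup_monotone hcard
  refine lt_of_lt_of_le ?_ (netEntropyEntourage_le_coverEntropy T Set.univ hU)
  by_contra hneg
  have h2 : 0 < ENNReal.log 2 := by
    rw [← ENNReal.log_one]
    exact ENNReal.log_strictMono (by norm_num)
  exact absurd (h2.trans_le hgrow) (not_lt.2 (mul_nonpos_of_nonneg_of_nonpos (by positivity)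
    (not_lt.1 hneg)))

/-- If each of the sets `S b` is covered by the image of each of them, every word is realized. -/
theorem exists_orbit_mem_of_subset_image {α : Type*} (g : α → α) (S : Bool → Set α)
    (hne : ∀ b, (S b).Nonempty) (hS : ∀ b c, S c ⊆ g '' S b) (n : ℕ) (w : ℕ → Bool) :
    ∃ x ∈ S (w 0), ∀ i < n, g^[i] x ∈ S (w i) := by
  induction n generalizing w with
  | zero => exact ⟨(hne (w 0)).some, (hne (w 0)).some_mem, by simp⟩
  | succ n ih =>
    obtain ⟨y, hy, hyw⟩ := ih fun i => w (i + 1)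
    obtain ⟨x, hx, rfl⟩ := hS (w 0) _ hy
    refine ⟨x, hx, fun i hi => ?_⟩
    cases i with
    | zero => exact hx
    | succ i => exact hyw i (by omega)

section Interval

variable {α : Type*} [ConditionallyCompleteLinearOrder α] [TopologicalSpace α] [OrderTopology α]
  [DenselyOrdered α]

/-- A continuous map sending two adjacent intervals over their union has a square with a horseshoe
made of two disjoint intervals. -/
theorem exists_disjoint_horseshoe_of_adjacent {g : α → α} (hg : Continuous g) {a b c : α}
    (hab : a < b) (hbc : b < c) (h₁ : Set.Icc a c ⊆ g '' Set.Icc a b)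
    (h₂ : Set.Icc a c ⊆ g '' Set.Icc b c) :
    ∃ p q, b < p ∧ p ≤ q ∧ q ≤ c ∧ Set.Icc a c ⊆ g^[2] '' Set.Icc a b ∧
      Set.Icc a c ⊆ g^[2] '' Set.Icc p q := by
  have hac := hab.trans hbc
  have hsub : Set.Icc a c ⊆ g^[2] '' Set.Icc a b := by
    intro y hy
    obtain ⟨x, hx, rfl⟩ := h₁ hy
    obtain ⟨t, ht, rfl⟩ := h₁ (Set.Icc_subset_Icc_right hbc.le hx)
    exact ⟨t, ht, rfl⟩
  obtain ⟨s, hs, hsa⟩ := h₂ (Set.left_mem_Icc.2 hac.le)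
  obtain ⟨t, ht, htc⟩ := h₂ (Set.right_mem_Icc.2 hac.le)
  obtain ⟨u, hu, hub⟩ : b ∈ g '' Set.uIcc s t := by
    refine intermediate_value_uIcc hg.continuousOn ?_
    rw [hsa, htc, Set.uIcc_of_le hac.le]
    exact ⟨hab.le, hbc.le⟩
  have hus : u ≠ s := by rintro rfl; exact hab.ne (hsa.symm.trans hub)
  have hut : u ≠ t := by rintro rfl; exact hbc.ne (hub.symm.trans htc)
  rcases le_total s t with hst | hst
  · rw [Set.uIcc_of_le hst] at hu
    refine ⟨u, t, hs.1.trans_lt (lt_of_le_of_ne hu.1 hus.symm), hu.2, ht.2, hsub, fun y hy => ?_⟩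
    obtain ⟨x, hx, rfl⟩ := h₂ hy
    have : x ∈ g '' Set.Icc u t := by
      refine intermediate_value_Icc hu.2 hg.continuousOn ?_
      rwa [hub, htc]
    obtain ⟨v, hv, rfl⟩ := this
    exact ⟨v, hv, rfl⟩
  · rw [Set.uIcc_of_ge hst] at hu
    refine ⟨u, s, ht.1.trans_lt (lt_of_le_of_ne hu.1 hut.symm), hu.2, hs.2, hsub, fun y hy => ?_⟩
    obtain ⟨x, hx, rfl⟩ := h₁ hy
    have : x ∈ g '' Set.Icc u s := by
      refine intermediate_value_Icc' hu.2 hg.continuousOn ?_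
      rwa [hub, hsa]
    obtain ⟨v, hv, rfl⟩ := this
    exact ⟨v, hv, rfl⟩

/-- A continuous map with a non-fixed point of odd period has an iterate which maps each of two
adjacent intervals over their union. -/
theorem exists_adjacent_horseshoe_of_odd_period {f : α → α} (hf : Continuous f) {r : ℕ}
    (hr : Odd r) {x₀ : α} (hper : f^[r] x₀ = x₀) (hfix : f x₀ ≠ x₀) :
    ∃ N ≠ 0, ∃ a b c, a < b ∧ b < c ∧ Set.Icc a c ⊆ f^[N] '' Set.Icc a b ∧
      Set.Icc a c ⊆ f^[N] '' Set.Icc b c := by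
  classical
  have hrpos : 0 < r := hr.pos
  have hisPer : Function.IsPeriodicPt f r x₀ := hper
  let P : Finset α := (Finset.range r).image fun i => f^[i] x₀
  have hmem : ∀ i, f^[i] x₀ ∈ P := fun i =>
    Finset.mem_image.2 ⟨i % r, Finset.mem_range.2 (Nat.mod_lt _ hrpos), hisPer.iterate_mod_apply i⟩
  have hP : ∀ {x}, x ∈ P → ∃ i, i < r ∧ f^[i] x₀ = x := fun hx => by
    obtain ⟨i, hi, h⟩ := Finset.mem_image.1 hx
    exact ⟨i, Finset.mem_range.1 hi, h⟩
  have hmap : ∀ {x}, x ∈ P → f x ∈ P := fun hx => by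
    obtain ⟨i, -, rfl⟩ := hP hx
    rw [← Function.iterate_succ_apply' f]
    exact hmem _
  have hperP : ∀ {x}, x ∈ P → f^[r] x = x := fun hx => by
    obtain ⟨i, -, rfl⟩ := hP hx
    exact hisPer.apply_iterate i
  have horb : ∀ {x y}, x ∈ P → y ∈ P → ∃ i ≤ r, f^[i] x = y := by
    intro x y hx hy
    obtain ⟨i, hi, rfl⟩ := hP hx
    obtain ⟨j, hj, rfl⟩ := hP hy
    refine ⟨(j + (r - i)) % r, (Nat.mod_lt _ hrpos).le, ?_⟩
    have hpx : Function.IsPeriodicPt f r (f^[i] x₀) := hisPer.apply_iterate i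
    rw [hpx.iterate_mod_apply, ← Function.iterate_add_apply,
      show j + (r - i) + i = j + r by omega, Function.iterate_add_apply, hper]
  have hnofix : ∀ {x}, x ∈ P → f x ≠ x := by
    intro x hx h
    obtain ⟨i, -, hi⟩ := horb hx (hmem 0)
    rw [Function.iterate_fixed h] at hi
    exact hfix (by simpa [hi] using h)
  have hPne : P.Nonempty := ⟨_, hmem 0⟩
  have hLne : (P.filter fun x => x < f x).Nonempty := by
    refine ⟨P.min' hPne, Finset.mem_filter.2 ⟨P.min'_mem hPne, ?_⟩⟩
    exact lt_of_le_of_ne (P.min'_le _ (hmap (P.min'_mem hPne))) (hnofix (P.min'_mem hPne)).symm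
  obtain ⟨z, hz, hzmax⟩ := (P.filter fun x => x < f x).exists_max_image id hLne
  obtain ⟨hzP, hzf⟩ := Finset.mem_filter.1 hz
  obtain ⟨y, hy, hymin⟩ := (P.filter fun x => z < x).exists_min_image id
    ⟨f z, Finset.mem_filter.2 ⟨hmap hzP, hzf⟩⟩
  obtain ⟨hyP, hzy⟩ := Finset.mem_filter.1 hy
  have hright : ∀ {x}, x ∈ P → z < x → y ≤ x := fun hx h => hymin _ (Finset.mem_filter.2 ⟨hx, h⟩)
  have hyf : f y ≤ z := by
    by_contra! h
    have h' : y < f y := lt_of_le_of_ne (hright (hmap hyP) h) (hnofix hyP).symm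
    exact absurd (hzmax y (Finset.mem_filter.2 ⟨hyP, h'⟩)) (not_le.2 hzy)
  have hfz : y ≤ f z := hright (hmap hzP) hzf
  have hJ : Set.Icc z y ⊆ f '' Set.Icc z y :=
    (Set.Icc_subset_Icc hyf hfz).trans (intermediate_value_Icc' hzy.le hf.continuousOn)
  have hmono : Monotone fun k => f^[k] '' Set.Icc z y := by
    refine monotone_nat_of_le_succ fun k => ?_
    rw [Function.iterate_succ, Set.image_comp]
    exact Set.image_mono hJ
  have hPr : ∀ {x}, x ∈ P → x ∈ f^[r] '' Set.Icc z y := fun hx => by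
    obtain ⟨i, hi, rfl⟩ := horb hzP hx
    exact hmono hi ⟨z, Set.left_mem_Icc.2 hzy.le, rfl⟩
  have hconn : (f^[r] '' Set.Icc z y).OrdConnected :=
    (isPreconnected_Icc.image _ (hf.iterate r).continuousOn).ordConnected
  have hhull : ∀ {s t}, s ∈ P → t ∈ P → Set.Icc s t ⊆ f^[r] '' Set.Icc z y := fun hs ht =>
    hconn.out (hPr hs) (hPr ht)
  have hcoverJ : ∀ {s t}, s ∈ P → t ∈ P → Set.Icc s t ⊆ f^[r + 1] '' Set.Icc z y :=
    fun hs ht => (hhull hs ht).trans (hmono r.le_succ)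
  have hcover : ∀ {s t : α} {K : Set α}, s ∈ P → t ∈ P → Set.Icc z y ⊆ f '' K →
      Set.Icc s t ⊆ f^[r + 1] '' K := fun hs ht hK => by
    rw [Function.iterate_succ, Set.image_comp]
    exact (hhull hs ht).trans (Set.image_mono hK)
  have hside : (∃ x ∈ P, x ≤ z ∧ f x ≤ z) ∨ ∃ x ∈ P, z < x ∧ z < f x := by
    by_contra! hcon
    obtain ⟨hl, hr'⟩ := hcon
    have halt : ∀ i, f^[i] z ∈ P ∧ (Even i ↔ f^[i] z ≤ z) := by
      intro i
      induction i with
      | zero => simpa using hzP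
      | succ i ih =>
        rw [Function.iterate_succ_apply']
        refine ⟨hmap ih.1, ?_⟩
        rw [Nat.even_add_one, ih.2]
        refine ⟨fun h => hr' _ ih.1 (not_le.1 h), fun h h' => ?_⟩
        exact absurd (hl _ ih.1 h') (not_lt.2 h)
    exact (Nat.not_even_iff_odd.2 hr) ((halt r).2.2 (hperP hzP).le)
  refine ⟨r + 1, r.succ_ne_zero, ?_⟩
  rcases hside with ⟨x, hxP, hxz, hfx⟩ | ⟨x, hxP, hzx, hfx⟩
  · have hlt : x < z := lt_of_le_of_ne hxz (by rintro rfl; exact absurd hzf (not_lt.2 hfx))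
    refine ⟨x, z, y, hlt, hzy, hcover hxP hyP ?_, hcoverJ hxP hyP⟩
    exact (Set.Icc_subset_Icc hfx hfz).trans (intermediate_value_Icc hlt.le hf.continuousOn)
  · have hlt : y < x := lt_of_le_of_ne (hright hxP hzx)
      (by rintro rfl; exact absurd hfx (not_lt.2 hyf))
    refine ⟨z, y, x, hzy, hlt, hcoverJ hzP hxP, hcover hzP hxP ?_⟩
    exact (Set.Icc_subset_Icc hyf (hright (hmap hxP) hfx)).trans
      (intermediate_value_Icc hlt.le hf.continuousOn)

/-- A continuous map with a non-fixed point of odd period has an iterate realizing all words in two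
disjoint closed sets. -/
theorem exists_realizes_words_of_odd_period {f : α → α} (hf : Continuous f) {r : ℕ}
    (hr : Odd r) {x₀ : α} (hper : f^[r] x₀ = x₀) (hfix : f x₀ ≠ x₀) :
    ∃ N ≠ 0, ∃ S : Bool → Set α, (∀ b, IsClosed (S b)) ∧ Disjoint (S true) (S false) ∧
      ∀ (n : ℕ) (w : ℕ → Bool), ∃ x, ∀ i < n, (f^[N])^[i] x ∈ S (w i) := by
  obtain ⟨N, hN, a, b, c, hab, hbc, h₁, h₂⟩ :=
    exists_adjacent_horseshoe_of_odd_period hf hr hper hfix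
  obtain ⟨p, q, hbp, hpq, hqc, h₃, h₄⟩ :=
    exists_disjoint_horseshoe_of_adjacent (hf.iterate N) hab hbc h₁ h₂
  rw [← Function.iterate_mul] at h₃ h₄
  refine ⟨N * 2, by omega, fun s => if s then Set.Icc a b else Set.Icc p q, ?_, ?_, ?_⟩
  · rintro (_ | _) <;> simp [isClosed_Icc]
  · simp only [if_true, Bool.false_eq_true, if_false]
    exact Set.disjoint_left.2 fun x hx hx' => absurd (hx.2.trans_lt hbp) (not_lt.2 hx'.1)
  · intro n w
    have hab' : Set.Icc a b ⊆ Set.Icc a c := Set.Icc_subset_Icc_right hbc.le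
    have hpq' : Set.Icc p q ⊆ Set.Icc a c := Set.Icc_subset_Icc (hab.trans hbp).le hqc
    obtain ⟨x, -, hx⟩ := exists_orbit_mem_of_subset_image (f^[N * 2])
      (fun s : Bool => if s then Set.Icc a b else Set.Icc p q)
      (by rintro (_ | _) <;> simp [hab.le, hpq])
      (by
        rintro (_ | _) (_ | _) <;> simp only [if_true, Bool.false_eq_true, if_false]
        exacts [hpq'.trans h₄, hab'.trans h₄, hpq'.trans h₃, hab'.trans h₃]) n w
    exact ⟨x, hx⟩

end Interval

/-- If an iterate of a map `T` of a compact space realizes, up to a continuous observable `π`, all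
words in two disjoint closed sets, then `T` has positive entropy. -/
theorem coverEntropy_pos_of_observable {X Y : Type*} [UniformSpace X] [CompactSpace X]
    [TopologicalSpace Y] (T : X → X) {π : X → Y} (hπ : Continuous π) {M : ℕ} (hM : M ≠ 0)
    (S : Bool → Set Y) (hS : ∀ b, IsClosed (S b)) (hdisj : Disjoint (S true) (S false))
    (hwords : ∀ (n : ℕ) (w : ℕ → Bool), ∃ x, ∀ i < n, π ((T^[M])^[i] x) ∈ S (w i)) :
    0 < coverEntropy T Set.univ := by
  obtain ⟨U, hU, hUd⟩ := (hdisj.preimage π).exists_uniform_thickening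
    ((hS true).preimage hπ).isCompact ((hS false).preimage hπ)
  refine coverEntropy_pos_of_realizes_words T hM (fun b => π ⁻¹' S b) hU ?_ hwords
  intro a ha b hb
  exact hUd.mono (Set.subset_biUnion_of_mem (u := fun x => UniformSpace.ball x U) ha)
    (Set.subset_biUnion_of_mem (u := fun x => UniformSpace.ball x U) hb)

/-- The first coordinate is a semiconjugacy from a triangular map to its base map. -/
theorem fst_triMap_iterate (f : I → I) (g : I × I → I) (n : ℕ) (z : I × I) :
    ((triMap f g)^[n] z).1 = f^[n] z.1 :=
  (Function.Semiconj.iterate_right (f := Prod.fst) (ga := triMap f g) (gb := f)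
    (fun _ => rfl) n) z

/-- If a continuous triangular map `T` is of type greater than `2^∞`, i.e. it has a
periodic point whose minimal period is not a power of `2`, then `h T > 0`. -/
theorem triMap_entropy_pos_of_type_gt_two_inf (f : I → I) (g : I × I → I)
    (hf : Continuous f) (hg : Continuous g)
    (htype : ∃ (z : I × I) (n : ℕ), MinPeriod (triMap f g) z n ∧ ¬∃ k : ℕ, n = 2 ^ k) :
    0 < coverEntropy (triMap f g) Set.univ := by
  obtain ⟨z, n, ⟨hn, hper, hmin⟩, hpow⟩ := htype
  obtain ⟨s, r, hr, rfl⟩ := Nat.exists_eq_two_pow_mul_odd hn.ne'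
  have hs : (2 : ℕ) ^ s ≠ 0 := by positivity
  have hr1 : 1 < r := by
    refine lt_of_le_of_ne hr.pos ?_
    rintro rfl
    exact hpow ⟨s, by simp⟩
  have hfix : (triMap f g)^[2 ^ s] z ≠ z :=
    hmin _ (by positivity) (lt_mul_of_one_lt_right (by positivity) hr1)
  rw [Function.iterate_mul] at hper
  have hT : Continuous (triMap f g) := (hf.comp continuous_fst).prodMk hg
  set F := (triMap f g)^[2 ^ s] with hF
  have hFc : Continuous F := hT.iterate _
  have hF1 : ∀ i w, (F^[i] w).1 = (f^[2 ^ s])^[i] w.1 := fun i w => by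
    rw [hF, ← Function.iterate_mul, ← Function.iterate_mul, fst_triMap_iterate]
  by_cases hx : f^[2 ^ s] z.1 = z.1
  · set φ : I → I := fun y => (F (z.1, y)).2 with hφ
    have hφc : Continuous φ := continuous_snd.comp (hFc.comp (by fun_prop))
    have hfib : ∀ i y, F^[i] (z.1, y) = (z.1, φ^[i] y) := by
      intro i
      induction i with
      | zero => intro y; rfl
      | succ i ih =>
        intro y
        rw [Function.iterate_succ_apply', ih, Function.iterate_succ_apply']
        exact Prod.ext ((hF1 1 _).trans hx) rfl
    have hφper : φ^[r] z.2 = z.2 := congrArg Prod.snd ((hfib r z.2).symm.trans hper)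
    have hφfix : φ z.2 ≠ z.2 := fun h => hfix <| (hfib 1 z.2).trans (Prod.ext rfl h)
    obtain ⟨N, hN, S, hS, hd, hw⟩ := exists_realizes_words_of_odd_period hφc hr hφper hφfix
    refine coverEntropy_pos_of_observable _ continuous_snd (mul_ne_zero hs hN) S hS hd ?_
    intro n w
    obtain ⟨y, hy⟩ := hw n w
    refine ⟨(z.1, y), fun i hi => ?_⟩
    rw [Function.iterate_mul, ← hF, ← Function.iterate_mul, hfib, Function.iterate_mul]
    exact hy i hi
  · have hfper : (f^[2 ^ s])^[r] z.1 = z.1 := by rw [← hF1, hper]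
    obtain ⟨N, hN, S, hS, hd, hw⟩ :=
      exists_realizes_words_of_odd_period (hf.iterate (2 ^ s)) hr hfper hx
    refine coverEntropy_pos_of_observable _ continuous_fst (mul_ne_zero hs hN) S hS hd ?_
    intro n w
    obtain ⟨x, hx⟩ := hw n w
    refine ⟨(x, z.2), fun i hi => ?_⟩
    rw [Function.iterate_mul, ← hF, ← Function.iterate_mul, hF1, Function.iterate_mul]
    exact hx i hi
end

section
/- If a continuous triangular map T on I × I is of type less than 2^∞, i.e. there exists k ∈ ℕ such that the set of minimal periods of periodic points of T is exactly {1, 2, 4, …, 2^k}, then the topological entropy of T is zero: h(T) = 0. -/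
open Function Dynamics

/-- The unit interval `[0,1]`. -/
local notation "I" => unitInterval

open MeasureTheory Filter Topology in
theorem exists_empirical_measure {X : Type*} [TopologicalSpace X]
    [MeasurableSpace X] [BorelSpace X] (S : X → X) (n : ℕ) (hn : n ≠ 0) (z : X) :
    ∃ μ : ProbabilityMeasure X, ∀ h : X → ℝ, Continuous h →
      ∫ x, h x ∂(μ : Measure X) = (n : ℝ)⁻¹ * ∑ i ∈ Finset.range n, h (S^[i] z) := by
  refine ⟨⟨(n : ENNReal)⁻¹ • ∑ i ∈ Finset.range n, Measure.dirac (S^[i] z), ⟨?_⟩⟩, fun h hh => ?_⟩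
  · simp [ENNReal.inv_mul_cancel, hn]
  · simp only [ProbabilityMeasure.coe_mk, integral_smul_measure]
    rw [integral_finsetSum_measure]
    · simp [integral_dirac' _ _ hh.stronglyMeasurable]
    · intro i _
      exact integrable_dirac' hh.stronglyMeasurable (by simp)

open MeasureTheory Filter Topology in
/-- If all recurrent points of `S` are fixed, then the average step length along an orbit tends to
zero uniformly, since every invariant probability measure lives on the fixed points. -/
theorem eventually_sum_dist_iterate_le {X : Type*} [MetricSpace X] [CompactSpace X]
    [MeasurableSpace X] [BorelSpace X] {S : X → X} (hS : Continuous S)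
    (hrec : ∀ z, (∀ V ∈ 𝓝 z, ∃ᶠ n in atTop, S^[n] z ∈ V) → S z = z) {ε : ℝ} (hε : 0 < ε) :
    ∀ᶠ n : ℕ in atTop, ∀ z,
      ∑ i ∈ Finset.range n, dist (S^[i] z) (S^[i + 1] z) ≤ ε * n := by
  by_contra hcon
  have hcd : Continuous fun z => dist z (S z) := continuous_id.dist hS
  have key : ∀ k : ℕ, ∃ μ : ProbabilityMeasure X, ε ≤ ∫ x, dist x (S x) ∂(μ : Measure X) ∧
      ∀ h : X → ℝ, Continuous h → ∀ C, (∀ x, |h x| ≤ C) →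
        |∫ x, h (S x) ∂(μ : Measure X) - ∫ x, h x ∂(μ : Measure X)| ≤
          2 * C * (1 / ((k : ℝ) + 1)) := by
    intro k
    obtain ⟨n, hn, hz⟩ := (Filter.not_eventually.1 hcon).forall_exists_of_atTop (k + 1)
    push Not at hz
    obtain ⟨z, hz⟩ := hz
    have hn0 : (0 : ℝ) < n := by exact_mod_cast (show 0 < n by omega)
    obtain ⟨μ, hμ⟩ := exists_empirical_measure S n (by omega) z
    refine ⟨μ, ?_, fun h hh C hC => ?_⟩
    · rw [hμ _ hcd, inv_mul_eq_div, le_div_iff₀ hn0]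
      simpa only [iterate_succ_apply'] using hz.le
    · rw [hμ (fun x => h (S x)) (hh.comp hS), hμ _ hh, ← mul_sub, ← Finset.sum_sub_distrib]
      simp only [← iterate_succ_apply' S]
      rw [Finset.sum_range_sub (fun i => h (S^[i] z)), abs_mul, abs_of_pos (inv_pos.2 hn0), mul_comm,
        one_div]
      have hC0 : 0 ≤ C := (abs_nonneg _).trans (hC z)
      have hkn : (k : ℝ) + 1 ≤ n := by exact_mod_cast hn
      gcongr
      calc _ ≤ |h (S^[n] z)| + |h (S^[0] z)| := abs_sub _ _
        _ ≤ 2 * C := by linarith [hC (S^[n] z), hC (S^[0] z)]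
  choose μ hμ₁ hμ₂ using key
  obtain ⟨ν, -, hν⟩ := isCompact_univ (X := ProbabilityMeasure X)
    |>.ultrafilter_le_nhds ((hyperfilter ℕ).map μ) (by simp)
  replace hν : Tendsto μ (hyperfilter ℕ) (𝓝 ν) := hν
  rw [ProbabilityMeasure.tendsto_iff_forall_integral_tendsto] at hν
  have hν' : ∀ h : X → ℝ, Continuous h → Tendsto (fun k => ∫ x, h x ∂(μ k : Measure X))
      (hyperfilter ℕ) (𝓝 (∫ x, h x ∂(ν : Measure X))) := fun h hh =>
    hν (BoundedContinuousFunction.mkOfCompact ⟨h, hh⟩)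
  have hinv : Measure.map S (ν : Measure X) = ν := by
    apply ext_of_forall_integral_eq_of_IsFiniteMeasure
    intro h
    rw [integral_map hS.aemeasurable h.continuous.aestronglyMeasurable]
    have h1 := (hν' _ (h.continuous.comp hS)).sub (hν' _ h.continuous)
    have h2 : Tendsto (fun k : ℕ => 2 * ‖h‖ * (1 / ((k : ℝ) + 1))) (hyperfilter ℕ) (𝓝 0) := by
      have := (tendsto_one_div_add_atTop_nhds_zero_nat (𝕜 := ℝ)).const_mul (2 * ‖h‖)
      rw [mul_zero] at this
      exact this.mono_left Nat.hyperfilter_le_atTop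
    have h3 := squeeze_zero_norm
      (f := fun k => ∫ x, h (S x) ∂(μ k : Measure X) - ∫ x, h x ∂(μ k : Measure X))
      (fun k => hμ₂ k h h.continuous ‖h‖ h.norm_coe_le_norm) h2
    exact sub_eq_zero.1 (tendsto_nhds_unique h1 h3)
  have hmp : MeasurePreserving S (ν : Measure X) ν := ⟨hS.measurable, hinv⟩
  have hfix : ∀ᵐ x ∂(ν : Measure X), dist x (S x) = 0 := by
    filter_upwards [hmp.conservative.ae_frequently_mem_of_mem_nhds] with x hx
    rw [hrec x hx, dist_self]
  have hpos : ε ≤ ∫ x, dist x (S x) ∂(ν : Measure X) :=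
    ge_of_tendsto' (hν' _ hcd) hμ₁
  rw [integral_congr_ae hfix] at hpos
  simp at hpos
  linarith

open Topology Filter in
theorem lt_iterate_of_lt_map {α : Type*} [ConditionallyCompleteLinearOrder α] [BoundedOrder α]
    [TopologicalSpace α] [OrderTopology α] [DenselyOrdered α] {φ : α → α} (hφ : Continuous φ)
    (hper : ∀ m, 0 < m → ∀ y, φ^[m] y = y → φ y = y) {x : α} (hx : x < φ x) {n : ℕ}
    (hn : 0 < n) : x < φ^[n] x := by
  by_contra! hcon
  have hφn := hφ.iterate n
  set F : Set α := {y | y ≤ x ∧ φ y = y} with hF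
  have hFc : IsClosed F := isClosed_Iic.inter (isClosed_eq hφ continuous_id)
  have hFne : F.Nonempty := by
    obtain ⟨y, hy, hfix⟩ := exists_mem_Icc_isFixedPt hφn.continuousOn (bot_le (a := x)) bot_le hcon
    exact ⟨y, hy.2, hper n hn y hfix⟩
  have hFb : BddAbove F := ⟨x, fun y hy => hy.1⟩
  have hp : sSup F ∈ F := hFc.csSup_mem hFne hFb
  have hmax : ∀ y ∈ F, y ≤ sSup F := fun y hy => le_csSup hFb hy
  set p := sSup F
  have hpx : p < x := lt_of_le_of_ne hp.1 fun h => hx.ne' (h ▸ hp.2)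
  have hup : ∀ y, p < y → y ≤ x → y < φ y := by
    intro y hpy hyx
    by_contra! h
    obtain ⟨q, hq, hfix⟩ := exists_mem_uIcc_isFixedPt hφ.continuousOn hx.le h
    rw [Set.uIcc_of_ge hyx] at hq
    exact (hpy.trans_le hq.1).not_ge (hmax q ⟨hq.2, hfix⟩)
  have hdown : ∀ y, p < y → y ≤ x → φ^[n] y < y := by
    intro y hpy hyx
    by_contra! h
    obtain ⟨q, hq, hfix⟩ := exists_mem_Icc_isFixedPt hφn.continuousOn hyx h hcon
    exact (hpy.trans_le hq.1).not_ge (hmax q ⟨hq.2, hper n hn q hfix⟩)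
  have hnear : ∀ᶠ y in 𝓝 p, ∀ i ∈ Finset.range (n + 1), φ^[i] y < x := by
    rw [Filter.eventually_all_finset]
    intro i _
    apply (hφ.iterate i).continuousAt.eventually_lt_const
    rwa [iterate_fixed hp.2]
  have : (𝓝[>] p).NeBot := nhdsGT_neBot_of_exists_gt ⟨x, hpx⟩
  obtain ⟨y, hy, hpy⟩ := ((hnear.filter_mono nhdsWithin_le_nhds).and
    (self_mem_nhdsWithin : Set.Ioi p ∈ 𝓝[>] p)).exists
  have hmono : ∀ i ≤ n, y ≤ φ^[i] y := by
    intro i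
    induction i with
    | zero => simp
    | succ i ih =>
      intro hi
      rw [iterate_succ_apply']
      have h1 := ih (by omega)
      exact h1.trans (hup _ (lt_of_lt_of_le hpy h1) (hy i (by simp; omega)).le).le
  exact (hdown y hpy (hy 0 (by simp)).le).not_ge (hmono n le_rfl)

open Topology Filter in
theorem map_le_of_recurrent {α : Type*} [ConditionallyCompleteLinearOrder α] [BoundedOrder α]
    [TopologicalSpace α] [OrderTopology α] [DenselyOrdered α] {φ : α → α} (hφ : Continuous φ)
    (hper : ∀ m, 0 < m → ∀ y, φ^[m] y = y → φ y = y) {x : α}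
    (hrec : ∀ V ∈ 𝓝 x, ∃ᶠ n in atTop, φ^[n] x ∈ V) : φ x ≤ x := by
  by_contra! hx
  obtain ⟨c, hxc, hcx⟩ := exists_between hx
  obtain ⟨m, hm, hmV⟩ := (hrec _ ((isOpen_Iio.inter (isOpen_Ioi.preimage hφ)).mem_nhds
    ⟨hxc, hcx⟩)).forall_exists_of_atTop 1
  have hup : φ^[m] x < φ (φ^[m] x) := lt_trans hmV.1 hmV.2
  obtain ⟨j, hj, hjV⟩ := (hrec _ (Iio_mem_nhds
    (lt_iterate_of_lt_map hφ hper hx hm))).forall_exists_of_atTop (m + 1)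
  have h := lt_iterate_of_lt_map hφ hper hup (n := j - m) (by omega)
  rw [← iterate_add_apply, Nat.sub_add_cancel (by omega)] at h
  exact lt_asymm h hjV

open Topology Filter in
theorem map_eq_of_recurrent {α : Type*} [ConditionallyCompleteLinearOrder α] [BoundedOrder α]
    [TopologicalSpace α] [OrderTopology α] [DenselyOrdered α] {φ : α → α} (hφ : Continuous φ)
    (hper : ∀ m, 0 < m → ∀ y, φ^[m] y = y → φ y = y) {x : α}
    (hrec : ∀ V ∈ 𝓝 x, ∃ᶠ n in atTop, φ^[n] x ∈ V) : φ x = x :=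
  (map_le_of_recurrent hφ hper hrec).antisymm
    (map_le_of_recurrent (α := αᵒᵈ) (φ := φ) hφ hper hrec)

open Topology Filter in
theorem skewProduct_map_eq_of_recurrent {α β : Type*}
    [ConditionallyCompleteLinearOrder α] [BoundedOrder α]
    [TopologicalSpace α] [OrderTopology α] [DenselyOrdered α]
    [ConditionallyCompleteLinearOrder β] [BoundedOrder β]
    [TopologicalSpace β] [OrderTopology β] [DenselyOrdered β]
    {S : α × β → α × β} {F : α → α} (hS : Continuous S) (hF : Continuous F)
    (hSF : Semiconj Prod.fst S F) (hper : ∀ m, 0 < m → ∀ z, S^[m] z = z → S z = z) {z : α × β}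
    (hrec : ∀ V ∈ 𝓝 z, ∃ᶠ n in atTop, S^[n] z ∈ V) : S z = z := by
  have hFper : ∀ m, 0 < m → ∀ x, F^[m] x = x → F x = x := by
    intro m hm x hx
    have hc : Continuous fun y : β => (S^[m] (x, y)).2 := by
      have := hS.iterate m
      fun_prop
    obtain ⟨y, -, hy⟩ := exists_mem_Icc_isFixedPt hc.continuousOn (bot_le (a := (⊤ : β)))
      bot_le le_top
    have h := hper m hm (x, y) (Prod.ext (((hSF.iterate_right m) (x, y)).trans hx) hy)
    have h' := hSF (x, y)
    rw [h] at h'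
    exact h'.symm
  obtain ⟨x, y⟩ := z
  have hx : F x = x := by
    refine map_eq_of_recurrent hF hFper fun V hV => ?_
    refine (hrec _ (continuous_fst.continuousAt.preimage_mem_nhds hV)).mono fun n hn => ?_
    rwa [← hSF.iterate_right n (x, y)]
  have hSx : ∀ y, S (x, y) = (x, (S (x, y)).2) := fun y => Prod.ext ((hSF (x, y)).trans hx) rfl
  have hiter : ∀ n y, S^[n] (x, y) = (x, (fun y => (S (x, y)).2)^[n] y) := by
    intro n
    induction n with
    | zero => intro y; rfl
    | succ n ih => intro y; rw [iterate_succ_apply, hSx, ih, iterate_succ_apply]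
  rw [hSx]
  refine Prod.ext rfl (map_eq_of_recurrent (φ := fun y => (S (x, y)).2) (by fun_prop) ?_ ?_)
  · intro m hm y hy
    have h : S^[m] (x, y) = (x, y) := by rw [hiter, hy]
    exact congrArg Prod.snd (hper m hm (x, y) h)
  · intro V hV
    refine (hrec _ (continuous_snd.continuousAt.preimage_mem_nhds hV)).mono fun n hn => ?_
    rw [hiter] at hn
    exact hn

/-- Follows the orbit of `z`, keeping an anchor point which is replaced by the current point of the
orbit as soon as the two are `η` apart; each time this happens, the label `p` of the new anchor is
recorded. -/
noncomputable def anchoredItinerary {X ι : Type*} [PseudoMetricSpace X] (S : X → X) (η : ℝ)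
    (p : X → ι) (z : X) : ℕ → X × Option ι
  | 0 => (z, some (p z))
  | t + 1 =>
    open Classical in
    if η ≤ dist (S^[t + 1] z) (anchoredItinerary S η p z t).1 then
      (S^[t + 1] z, some (p (S^[t + 1] z)))
    else ((anchoredItinerary S η p z t).1, none)

section anchoredItinerary

variable {X ι : Type*} [PseudoMetricSpace X] {S : X → X} {η : ℝ} {p : X → ι}

theorem dist_anchoredItinerary_lt (hη : 0 < η) (z : X) (t : ℕ) :
    dist (S^[t] z) (anchoredItinerary S η p z t).1 < η := by
  cases t with
  | zero => simpa [anchoredItinerary] using hη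
  | succ t =>
    rw [anchoredItinerary]
    split_ifs with h
    · simpa using hη
    · exact not_le.1 h

theorem dist_anchoredItinerary_lt_of_eq {δ : ℝ} (hp : ∀ x x', p x = p x' → dist x x' < δ)
    {z z' : X} {n : ℕ} (h : ∀ t < n,
      (anchoredItinerary S η p z t).2 = (anchoredItinerary S η p z' t).2) {t : ℕ} (ht : t < n) :
    dist (anchoredItinerary S η p z t).1 (anchoredItinerary S η p z' t).1 < δ := by
  induction t with
  | zero => exact hp _ _ (Option.some_injective _ (h 0 ht))
  | succ t ih =>
    have hc := h _ ht
    specialize ih (by omega)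
    rw [anchoredItinerary, anchoredItinerary] at hc ⊢
    by_cases h1 : η ≤ dist (S^[t + 1] z) (anchoredItinerary S η p z t).1 <;>
    by_cases h2 : η ≤ dist (S^[t + 1] z') (anchoredItinerary S η p z' t).1 <;>
    simp only [h1, h2, if_true, if_false] at hc ⊢
    · exact hp _ _ (Option.some_injective _ hc)
    · exact absurd hc (by simp)
    · exact absurd hc (by simp)
    · exact ih

theorem mul_sum_anchoredItinerary_le (z : X) (t : ℕ) :
    η * ∑ i ∈ Finset.range (t + 1), (anchoredItinerary S η p z i).2.elim (0 : ℝ) (fun _ => 1) +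
      dist (S^[t] z) (anchoredItinerary S η p z t).1 ≤
    η + ∑ i ∈ Finset.range t, dist (S^[i] z) (S^[i + 1] z) := by
  induction t with
  | zero => simp [anchoredItinerary]
  | succ t ih =>
    rw [Finset.sum_range_succ _ (t + 1), Finset.sum_range_succ (fun i => dist _ _) t, mul_add]
    have h := dist_triangle_left (S^[t + 1] z) (anchoredItinerary S η p z t).1 (S^[t] z)
    rw [anchoredItinerary]
    split_ifs with h1
    · simp only [Option.elim_some, dist_self]
      linarith
    · simp only [Option.elim_none]
      linarith

end anchoredItinerary

theorem sum_option_elim_exp {ι : Type*} [Fintype ι] (l : ℝ) :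
    ∑ o : Option ι, Real.exp (-l * o.elim 0 fun _ => 1) ≤
      Real.exp (Fintype.card ι * Real.exp (-l)) := by
  rw [Fintype.sum_option]
  simpa [add_comm] using Real.add_one_le_exp (Fintype.card ι * Real.exp (-l))

/-- Words with few letters other than `none` are few. -/
theorem card_le_of_forall_sum_elim_le {ι : Type*} [Fintype ι] {n : ℕ}
    (A : Finset (Fin n → Option ι)) {l r : ℝ} (hl : 0 ≤ l)
    (hA : ∀ c ∈ A, ∑ i, (c i).elim (0 : ℝ) (fun _ => 1) ≤ r) :
    (A.card : ℝ) ≤ Real.exp (l * r + n * (Fintype.card ι * Real.exp (-l))) := by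
  have h1 : ∑ c ∈ A, Real.exp (-(l * r)) ≤
      ∑ c : Fin n → Option ι, ∏ i, Real.exp (-l * (c i).elim 0 fun _ => 1) := by
    refine (Finset.sum_le_sum fun c hc => ?_).trans
      (Finset.sum_le_univ_sum_of_nonneg fun c => Finset.prod_nonneg fun i _ => (Real.exp_pos _).le)
    rw [← Real.exp_sum, Real.exp_le_exp, ← Finset.mul_sum]
    have := mul_le_mul_of_nonneg_left (hA c hc) hl
    linarith
  rw [← Fintype.sum_pow (fun o : Option ι => Real.exp (-l * o.elim 0 fun _ => 1)),
    Finset.sum_const, nsmul_eq_mul] at h1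
  have h2 := h1.trans (pow_le_pow_left₀ (Finset.sum_nonneg fun _ _ => (Real.exp_pos _).le)
    (sum_option_elim_exp l) n)
  rw [Real.exp_neg, ← div_eq_mul_inv, div_le_iff₀ (Real.exp_pos _), ← Real.exp_nat_mul,
    ← Real.exp_add] at h2
  rwa [add_comm]

open Filter in
theorem exists_isDynCoverOf_card_le_exp {X : Type*} [PseudoMetricSpace X] [CompactSpace X]
    {S : X → X} (hS : ∀ ε : ℝ, 0 < ε → ∀ᶠ n : ℕ in atTop, ∀ z,
      ∑ i ∈ Finset.range n, dist (S^[i] z) (S^[i + 1] z) ≤ ε * n)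
    {η ρ : ℝ} (hη : 0 < η) (hρ : 0 < ρ) :
    ∃ n ≠ 0, ∃ s : Finset X, IsDynCoverOf S Set.univ {q | dist q.1 q.2 < 4 * η} n (s : Set X) ∧
      (s.card : ℝ) ≤ Real.exp (ρ * n) := by
  classical
  obtain ⟨t, -, htf, htc⟩ := (isCompact_univ (X := X)).finite_cover_balls hη
  have : Fintype t := htf.fintype
  have hex : ∀ x : X, ∃ c : t, dist x c < η := fun x => by
    obtain ⟨c, hc, hxc⟩ := Set.mem_iUnion₂.1 (htc (Set.mem_univ x))
    exact ⟨⟨c, hc⟩, hxc⟩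
  choose p hp using hex
  have hpp : ∀ x x', p x = p x' → dist x x' < 2 * η := fun x x' h => by
    have h1 := hp x
    have h2 := hp x'
    rw [← h] at h2
    linarith [dist_triangle_right x x' (p x)]
  obtain ⟨l, hl1, hl0⟩ : ∃ l : ℝ, Fintype.card t * Real.exp (-l) ≤ ρ / 3 ∧ 0 < l := by
    have h : Tendsto (fun l : ℝ => (Fintype.card t : ℝ) * Real.exp (-l)) atTop (nhds 0) := by
      simpa using Real.tendsto_exp_neg_atTop_nhds_zero.const_mul (Fintype.card t : ℝ)
    exact ((h.eventually_le_const (by positivity)).and (eventually_gt_atTop 0)).exists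
  obtain ⟨n, hn1, hn2, hn3⟩ := ((hS (η * ρ / (3 * l)) (by positivity)).and
    ((tendsto_natCast_atTop_atTop.eventually_ge_atTop (3 * l / ρ)).and
      (eventually_ne_atTop 0))).exists
  let code : X → Fin n → Option t := fun z i => (anchoredItinerary S η p z i).2
  choose rep hrep using fun c : Set.range code => c.2
  refine ⟨n, hn3, Finset.univ.image rep, ?_, ?_⟩
  · intro z _
    refine ⟨_, Finset.mem_coe.2 (Finset.mem_image_of_mem _ (Finset.mem_univ ⟨_, z, rfl⟩)), ?_⟩
    have hw' := hrep ⟨code z, z, rfl⟩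
    set w := rep ⟨code z, z, rfl⟩
    rw [mem_dynEntourage]
    intro k hk
    have h1 := dist_anchoredItinerary_lt_of_eq (S := S) (η := η) hpp
      (fun i hi => (congrFun hw' ⟨i, hi⟩).symm) hk
    have h2 := dist_anchoredItinerary_lt (S := S) (p := p) hη z k
    have h3 := dist_anchoredItinerary_lt (S := S) (p := p) hη w k
    have h4 := dist_triangle4 (S^[k] z) (anchoredItinerary S η p z k).1
      (anchoredItinerary S η p w k).1 (S^[k] w)
    rw [dist_comm] at h3
    change dist (S^[k] z) (S^[k] w) < 4 * η
    linarith
  · have hcard : ((Finset.univ.image rep).card : ℝ) ≤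
        (Set.range code).toFinset.card := by
      rw [Set.toFinset_card]
      exact_mod_cast Finset.card_image_le
    refine hcard.trans ((card_le_of_forall_sum_elim_le _ (r := 1 + ρ / (3 * l) * n) hl0.le
      ?_).trans (Real.exp_le_exp.2 ?_))
    · intro c hc
      obtain ⟨z, rfl⟩ := Set.mem_toFinset.1 hc
      obtain ⟨m, rfl⟩ := Nat.exists_eq_succ_of_ne_zero hn3
      have h1 := mul_sum_anchoredItinerary_le (S := S) (η := η) (p := p) z m
      have h2 := hn1 z
      rw [Finset.sum_range_succ] at h2
      have h3 := dist_nonneg (x := S^[m] z) (y := (anchoredItinerary S η p z m).1)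
      have h4 := dist_nonneg (x := S^[m] z) (y := S^[m + 1] z)
      change ∑ i : Fin (m + 1), (anchoredItinerary S η p z i).2.elim (0 : ℝ) (fun _ => 1) ≤ _
      rw [Fin.sum_univ_eq_sum_range
        (fun i => (anchoredItinerary S η p z i).2.elim (0 : ℝ) (fun _ => 1)) (m + 1)]
      refine le_of_mul_le_mul_left ?_ hη
      have h5 : η * (1 + ρ / (3 * l) * ((m.succ : ℕ) : ℝ)) =
        η + η * ρ / (3 * l) * ((m.succ : ℕ) : ℝ) := by ring
      rw [h5]
      linarith
    · rw [div_le_iff₀ hρ] at hn2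
      have h1 : l * (1 + ρ / (3 * l) * n) = l + ρ / 3 * n := by field_simp
      have h2 : (n : ℝ) * (Fintype.card t * Real.exp (-l)) ≤ n * (ρ / 3) := by gcongr
      rw [h1]
      linarith

/-- If the orbits of some iterate of `T` are shadowed by subexponentially many of them, then the
entropy of `T` vanishes. -/
theorem coverEntropy_univ_nonpos {X : Type*} [PseudoMetricSpace X] [CompactSpace X] {T : X → X}
    (hT : Continuous T) {N : ℕ} (hN : N ≠ 0)
    (h : ∀ η ρ : ℝ, 0 < η → 0 < ρ → ∃ n ≠ 0, ∃ s : Finset X,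
      IsDynCoverOf T^[N] Set.univ {q | dist q.1 q.2 < 4 * η} n (s : Set X) ∧
        (s.card : ℝ) ≤ Real.exp (ρ * n)) :
    coverEntropy T Set.univ ≤ 0 := by
  refine iSup₂_le fun U hU => ?_
  obtain ⟨V, hV, hVsymm, hVU⟩ := comp_symm_mem_uniformity_sets hU
  refine (coverEntropyEntourage_antitone T _ hVU).trans ?_
  refine EReal.le_of_forall_lt_iff_le.1 fun ρ hρ => ?_
  have hρ' : 0 < ρ := by exact_mod_cast hρ
  have hunif := dynEntourage_mem_uniformity (CompactSpace.uniformContinuous_of_continuous hT) hV N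
  obtain ⟨ε, hε, hεV⟩ := Metric.mem_uniformity_dist.1 hunif
  obtain ⟨n, hn, s, hs, hcard⟩ := h (ε / 4) ρ (by positivity) hρ'
  have hs' : IsDynCoverOf T Set.univ V (n * N) (s : Set X) := by
    intro z hz
    obtain ⟨w, hw, hzw⟩ := hs hz
    refine ⟨w, hw, mem_dynEntourage.2 fun k hk => ?_⟩
    have h1 := mem_dynEntourage.1 hzw (k / N) (Nat.div_lt_of_lt_mul (by rwa [mul_comm]))
    have h2 : dist ((T^[N])^[k / N] z) ((T^[N])^[k / N] w) < ε := by
      have : dist _ _ < 4 * (ε / 4) := h1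
      linarith
    have h3 := mem_dynEntourage.1 (hεV h2) (k % N) (Nat.mod_lt _ (by omega))
    simpa only [← iterate_mul, ← iterate_add_apply, Nat.mod_add_div] using h3
  refine (hs'.coverEntropyEntourage_le_log_card_div (Set.mapsTo_univ _ _)
    (Nat.mul_ne_zero hn hN)).trans ?_
  have hlog : ENNReal.log (s.card : ENNReal) ≤ ((ρ * n : ℝ) : EReal) := by
    rw [← EReal.log_exp (ρ * n : ℝ)]
    refine ENNReal.log_le_log ?_
    rw [EReal.exp_coe, ← ENNReal.ofReal_natCast]
    exact ENNReal.ofReal_le_ofReal hcard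
  have hpos : (0 : EReal) < ((n * N : ℕ) : EReal) := by
    exact_mod_cast Nat.pos_of_ne_zero (Nat.mul_ne_zero hn hN)
  rw [EReal.div_le_iff_le_mul hpos (by exact EReal.natCast_ne_top _)]
  refine hlog.trans ?_
  have : (ρ * n : ℝ) ≤ (n * N : ℕ) * ρ := by
    rw [mul_comm]
    gcongr
    exact Nat.le_mul_of_pos_right n (by omega)
  exact_mod_cast this

theorem iterate_eq_of_minPeriod_le {X : Type*} {T : X → X} {k : ℕ}
    (hT : ∀ n z, MinPeriod T z n → ∃ j ≤ k, n = 2 ^ j) {m : ℕ} (hm : 0 < m) (z : X)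
    (hz : (T^[2 ^ k])^[m] z = z) : T^[2 ^ k] z = z := by
  have hper : z ∈ periodicPts T :=
    mk_mem_periodicPts (n := 2 ^ k * m) (by positivity) (by rwa [← iterate_mul] at hz)
  obtain ⟨j, hj, hjn⟩ := hT (minimalPeriod T z) z ⟨minimalPeriod_pos_of_mem_periodicPts hper,
    iterate_minimalPeriod, fun i hi hi' => not_isPeriodicPt_of_pos_of_lt_minimalPeriod hi.ne' hi'⟩
  have hdvd : minimalPeriod T z ∣ 2 ^ k := hjn ▸ pow_dvd_pow 2 hj
  exact isPeriodicPt_iff_minimalPeriod_dvd.2 hdvd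

/-- If a continuous triangular map `T` is of type less than `2^∞`, i.e. the set of
minimal periods of its periodic points is exactly `{1, 2, 4, …, 2^k}` for some `k`,
then `h T = 0`. -/
theorem triMap_entropy_zero_of_type_lt_two_inf (f : I → I) (g : I × I → I)
    (hf : Continuous f) (hg : Continuous g)
    (htype : ∃ k : ℕ,
      {n : ℕ | ∃ z : I × I, MinPeriod (triMap f g) z n} = {n : ℕ | ∃ j ≤ k, n = 2 ^ j}) :
    coverEntropy (triMap f g) Set.univ = 0 := by
  obtain ⟨k, hk⟩ := htype
  refine le_antisymm ?_ (coverEntropy_nonneg _ Set.univ_nonempty)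
  have hT : Continuous (triMap f g) := (hf.comp continuous_fst).prodMk hg
  have hsemi : Semiconj Prod.fst (triMap f g) f := fun _ => rfl
  refine coverEntropy_univ_nonpos hT (N := 2 ^ k) (by positivity) fun η ρ hη hρ => ?_
  refine exists_isDynCoverOf_card_le_exp (fun ε hε => ?_) hη hρ
  refine eventually_sum_dist_iterate_le (hT.iterate _) (fun z hz => ?_) hε
  refine skewProduct_map_eq_of_recurrent (hT.iterate _) (hf.iterate _) (hsemi.iterate_right _)
    (fun m hm w hw => ?_) hz
  refine iterate_eq_of_minPeriod_le (fun n v hv => ?_) hm w hw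
  have hn : n ∈ {n : ℕ | ∃ z : I × I, MinPeriod (triMap f g) z n} := ⟨v, hv⟩
  rw [hk] at hn
  exact hn
end

section
/- (Characteristic polynomial of a Kronecker product.) Let A be an n×n complex matrix and B an m×m complex matrix, and write the characteristic polynomials as charpoly(A) = ∏_{i=1}^{n}(X − α_i) and charpoly(B) = ∏_{j=1}^{m}(X − β_j) over ℂ. Then the characteristic polynomial of the Kronecker product satisfies P_{A⊗B}(X) = ∏_{i=1}^{n} ∏_{j=1}^{m} (X − α_i β_j); i.e., the eigenvalue multiset of A ⊗ B is the multiset of all products α_i β_j. -/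
open Polynomial Matrix Kronecker

section

variable {n R : Type*} [Fintype n] [DecidableEq n] [CommRing R] {A : Matrix n n R} {α : n → R}

theorem Matrix.charpoly_map_eq_prod {S : Type*} [CommRing S] (φ : R →+* S)
    (hA : A.charpoly = ∏ i, (X - C (α i))) :
    (A.map φ).charpoly = ∏ i, (X - C (φ (α i))) := by
  rw [charpoly_map, hA, Polynomial.map_prod]
  simp

theorem Matrix.det_scalar_sub_smul_of_field {K : Type*} [Field K] {A : Matrix n n K} {α : n → K}
    (hA : A.charpoly = ∏ i, (X - C (α i))) (x y : K) :
    (scalar n x - y • A).det = ∏ i, (x - y * α i) := by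
  rcases eq_or_ne y 0 with rfl | hy
  · simp
  · have h : scalar n x - y • A = y • (scalar n (x / y) - A) := by
      ext i j
      by_cases hij : i = j <;> simp [hij, mul_sub, mul_div_cancel₀ x hy]
    rw [h, det_smul, ← eval_charpoly, hA, eval_prod, ← Finset.card_univ, ← Finset.prod_const,
      ← Finset.prod_mul_distrib]
    refine Finset.prod_congr rfl fun i _ => ?_
    simp only [eval_sub, eval_X, eval_C]
    field_simp

/-- The homogeneous form of a factorization of the characteristic polynomial. -/
theorem Matrix.det_scalar_sub_smul [IsDomain R] (hA : A.charpoly = ∏ i, (X - C (α i))) (x y : R) :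
    (scalar n x - y • A).det = ∏ i, (x - y * α i) := by
  apply IsFractionRing.injective R (FractionRing R)
  set φ := algebraMap R (FractionRing R)
  have h : φ.mapMatrix (scalar n x - y • A) = scalar n (φ x) - φ y • A.map φ := by
    ext i j
    by_cases hij : i = j <;> simp [hij]
  rw [RingHom.map_det, h, det_scalar_sub_smul_of_field (charpoly_map_eq_prod φ hA)]
  simp

end

/-- Characteristic polynomial of a Kronecker product: if
`charpoly A = ∏ i, (X - α i)` and `charpoly B = ∏ j, (X - β j)` over `ℂ`, then
`charpoly (A ⊗ₖ B) = ∏ i, ∏ j, (X - α i * β j)`; i.e. the eigenvalue multiset of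
`A ⊗ₖ B` consists of all products `α i * β j`. -/
theorem charpoly_kronecker (n m : ℕ)
    (A : Matrix (Fin n) (Fin n) ℂ) (B : Matrix (Fin m) (Fin m) ℂ)
    (α : Fin n → ℂ) (β : Fin m → ℂ)
    (hA : A.charpoly = ∏ i, (X - C (α i)))
    (hB : B.charpoly = ∏ j, (X - C (β j))) :
    (A ⊗ₖ B).charpoly = ∏ i, ∏ j, (X - C (α i * β j)) := by
  let f : ℂ[X][X] →+* Matrix (Fin m) (Fin m) ℂ[X] := (aeval (B.map C)).toRingHom
  have hfC (p : ℂ[X]) : f (C p) = scalar (Fin m) p := aeval_C _ p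
  have hfX : f X = B.map C := aeval_X _
  let φ : ℂ →+* ℂ[X][X] := C.comp C
  have hcomp : comp _ _ _ _ _ ((scalar (Fin n) (C X) - (X : ℂ[X][X]) • A.map φ).map f) =
      charmatrix (A ⊗ₖ B) := by
    ext1 ⟨i, k⟩ ⟨j, l⟩
    rw [comp_apply, map_apply, Matrix.sub_apply, Matrix.smul_apply, map_apply, smul_eq_mul, map_sub, map_mul,
      hfX, RingHom.comp_apply, hfC, charmatrix_apply]
    by_cases hij : i = j <;> by_cases hkl : k = l <;>
      simp [hij, hkl, hfC, mul_comm]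
  rw [charpoly, ← hcomp, ← det_det, det_scalar_sub_smul (charpoly_map_eq_prod φ hA)]
  refine (map_prod (detMonoidHom.comp f.toMonoidHom) _ _).trans ?_
  refine Finset.prod_congr rfl fun i _ => ?_
  have h : f (C X - X * φ (α i)) = scalar (Fin m) X - C (α i) • B.map C := by
    rw [map_sub, map_mul, hfX, RingHom.comp_apply, hfC, hfC]
    ext1 k l
    simp [mul_comm]
  change (f (C X - X * φ (α i))).det = _
  rw [h, det_scalar_sub_smul (charpoly_map_eq_prod C hB)]
  simp
end
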